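/- arXiv:1708.02149 — 2 statements merged into one kernel-verified Lean document; each statement's English description precedes it below -/
import Mathlib

section
/- (Lemma 2) Let 0 < q < 1 and define ψ_QD(α) = (1 − q)^{-1}‖u_α − u_{qα}‖. Then for every α > 0: ψ_Q(α) ≤ ψ_QD(α) ≤ q^{-1}ψ_Q(qα). -/
open ContinuousLinearMap

/-- The resolvent identity for a family of inverses of `α + M`. -/
theorem shifted_inverse_eq_add {H : Type*} [NormedAddCommGroup H] [InnerProductSpace ℝ H]
    {M : H →L[ℝ] H} {T : ℝ → H →L[ℝ] H}
    (hL : ∀ α : ℝ, 0 < α → ∀ x, T α (α • x + M x) = x)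
    (hR : ∀ α : ℝ, 0 < α → ∀ x, α • T α x + M (T α x) = x)
    {α β : ℝ} (hα : 0 < α) (hβ : 0 < β) (v : H) :
    T β v = T α v + (α - β) • T β (T α v) := by
  have h : v = (β • T α v + M (T α v)) + (α - β) • T α v := by
    conv_lhs => rw [← hR α hα v]
    module
  conv_lhs => rw [h, map_add, hL β hβ, map_smul]

theorem shifted_inverse_comm {H : Type*} [NormedAddCommGroup H] [InnerProductSpace ℝ H]
    {M : H →L[ℝ] H} {T : ℝ → H →L[ℝ] H}
    (hL : ∀ α : ℝ, 0 < α → ∀ x, T α (α • x + M x) = x)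
    (hR : ∀ α : ℝ, 0 < α → ∀ x, α • T α x + M (T α x) = x)
    {α β : ℝ} (hα : 0 < α) (hβ : 0 < β) (v : H) :
    T β (T α v) = T α (T β v) := by
  rcases eq_or_ne α β with rfl | hne
  · rfl
  · refine smul_right_injective H (sub_ne_zero.2 hne) ?_
    have h₁ := shifted_inverse_eq_add hL hR hα hβ v
    have h₂ := shifted_inverse_eq_add hL hR hβ hα v
    change (α - β) • T β (T α v) = (α - β) • T α (T β v)
    linear_combination (norm := module) -h₁ - h₂

/-- For a positive operator `M`, the norm of `(α + M)⁻¹ v` is nonincreasing in `α`. -/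
theorem norm_shifted_inverse_le {H : Type*} [NormedAddCommGroup H] [InnerProductSpace ℝ H]
    {M : H →L[ℝ] H} {T : ℝ → H →L[ℝ] H}
    (hM : ∀ x, 0 ≤ inner ℝ (M x) x)
    (hL : ∀ α : ℝ, 0 < α → ∀ x, T α (α • x + M x) = x)
    (hR : ∀ α : ℝ, 0 < α → ∀ x, α • T α x + M (T α x) = x)
    {α β : ℝ} (hβ : 0 < β) (hβα : β ≤ α) (v : H) :
    ‖T α v‖ ≤ ‖T β v‖ := by
  have hpos : 0 ≤ inner ℝ (T α v) (T β (T α v)) := by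
    conv_rhs => enter [2]; rw [← hR β hβ (T α v)]
    rw [inner_add_left, real_inner_smul_left]
    exact add_nonneg (mul_nonneg hβ.le real_inner_self_nonneg) (hM _)
  rw [shifted_inverse_eq_add hL hR (hβ.trans_le hβα) hβ v]
  refine le_of_pow_le_pow_left₀ two_ne_zero (norm_nonneg _) ?_
  rw [norm_add_sq_real, real_inner_smul_right]
  nlinarith [mul_nonneg (sub_nonneg.2 hβα) hpos, sq_nonneg ‖(α - β) • T β (T α v)‖]

/-- Lemma 2: Let 0 < q < 1 and ψ_QD(α) = (1 − q)^{-1}‖u_α − u_{qα}‖.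
Then for every α > 0: ψ_Q(α) ≤ ψ_QD(α) ≤ q^{-1}ψ_Q(qα), where
ψ_Q(α) = α^{-1}‖A*B_α²(Au_α − f)‖ and B_α² = α(αI + AA*)^{-1}. -/
theorem stmt_6 {H F : Type*} [NormedAddCommGroup H] [InnerProductSpace ℝ H] [CompleteSpace H]
    [NormedAddCommGroup F] [InnerProductSpace ℝ F] [CompleteSpace F]
    (A : H →L[ℝ] F) (f : F)
    (T : ℝ → H →L[ℝ] H)
    (hT : ∀ α : ℝ, 0 < α →
      (α • (1 : H →L[ℝ] H) + (adjoint A) ∘L A) ∘L T α = 1 ∧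
      T α ∘L (α • (1 : H →L[ℝ] H) + (adjoint A) ∘L A) = 1)
    (S : ℝ → F →L[ℝ] F)
    (hS : ∀ α : ℝ, 0 < α →
      (α • (1 : F →L[ℝ] F) + A ∘L (adjoint A)) ∘L S α = 1 ∧
      S α ∘L (α • (1 : F →L[ℝ] F) + A ∘L (adjoint A)) = 1)
    (q : ℝ) (hq : 0 < q) (hq1 : q < 1)
    (α : ℝ) (hα : 0 < α) :
    α⁻¹ * ‖(adjoint A) ((α • S α) (A (T α ((adjoint A) f)) - f))‖ ≤
      (1 - q)⁻¹ * ‖T α ((adjoint A) f) - T (q * α) ((adjoint A) f)‖ ∧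
    (1 - q)⁻¹ * ‖T α ((adjoint A) f) - T (q * α) ((adjoint A) f)‖ ≤
      q⁻¹ * ((q * α)⁻¹ *
        ‖(adjoint A) (((q * α) • S (q * α)) (A (T (q * α) ((adjoint A) f)) - f))‖) := by
  have hL : ∀ α : ℝ, 0 < α → ∀ x, T α (α • x + (adjoint A ∘L A) x) = x := fun α hα x => by
    simpa using DFunLike.congr_fun (hT α hα).2 x
  have hR : ∀ α : ℝ, 0 < α → ∀ x, α • T α x + (adjoint A ∘L A) (T α x) = x := fun α hα x => by
    simpa using DFunLike.congr_fun (hT α hα).1 x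
  have hM : ∀ x, 0 ≤ inner ℝ ((adjoint A ∘L A) x) x := fun x => by
    rw [comp_apply, adjoint_inner_left]
    exact real_inner_self_nonneg
  have hS' : ∀ α : ℝ, 0 < α → ∀ y, adjoint A (S α y) = T α (adjoint A y) := fun α hα y => by
    have h : α • S α y + A (adjoint A (S α y)) = y := by
      simpa using DFunLike.congr_fun (hS α hα).1 y
    conv_rhs => rw [← h, map_add, map_smul]
    exact (hL α hα _).symm
  have hQ : ∀ α : ℝ, 0 < α →
      α⁻¹ * ‖adjoint A ((α • S α) (A (T α (adjoint A f)) - f))‖ =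
        α * ‖T α (T α (adjoint A f))‖ := fun α hα => by
    have h : adjoint A (A (T α (adjoint A f)) - f) = -(α • T α (adjoint A f)) := by
      rw [map_sub, sub_eq_iff_eq_add, ← comp_apply, eq_neg_add_iff_add_eq]
      exact hR α hα _
    rw [smul_apply, map_smul, hS' α hα, h, map_neg, map_smul, norm_smul, norm_neg, norm_smul,
      Real.norm_of_nonneg hα.le, inv_mul_cancel_left₀ hα.ne']
  have hβ : 0 < q * α := mul_pos hq hα
  have hβα : q * α ≤ α := mul_le_of_le_one_left hα.le hq1.le
  have hQD : (1 - q)⁻¹ * ‖T α (adjoint A f) - T (q * α) (adjoint A f)‖ =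
      α * ‖T (q * α) (T α (adjoint A f))‖ := by
    have hq' : 0 < 1 - q := sub_pos.2 hq1
    rw [norm_sub_rev, shifted_inverse_eq_add hL hR hα hβ, add_sub_cancel_left, norm_smul,
      show α - q * α = (1 - q) * α by ring, Real.norm_of_nonneg (mul_pos hq' hα).le, mul_assoc,
      inv_mul_cancel_left₀ hq'.ne']
  rw [hQ α hα, hQ _ hβ, hQD, mul_assoc q α, inv_mul_cancel_left₀ hq.ne']
  refine ⟨mul_le_mul_of_nonneg_left (norm_shifted_inverse_le hM hL hR hβ hβα _) hα.le,
    mul_le_mul_of_nonneg_left ?_ hα.le⟩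
  rw [shifted_inverse_comm hL hR hα hβ]
  exact norm_shifted_inverse_le hM hL hR hβ hβα _
end

section
/- For the geometric grid α_i = α_0 q^i and indices 0 ≤ j ≤ k ≤ M: ‖u_{α_k} − u_{α_j}‖ ≤ q^{-1}(1 − q) Σ_{i=j}^{k−1} ψ_Q(α_{i+1}). -/
open ContinuousLinearMap

/-- The resolvent identity for right and left inverses of `α • 1 + N` and `β • 1 + N`. -/
lemma resolvent_sub_apply {H : Type*} [NormedAddCommGroup H] [NormedSpace ℝ H]
    {N R R' : H →L[ℝ] H} {α β : ℝ}
    (hR : (α • (1 : H →L[ℝ] H) + N) ∘L R = 1)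
    (hR' : R' ∘L (β • (1 : H →L[ℝ] H) + N) = 1) (x : H) :
    R' x - R x = (α - β) • R' (R x) := by
  have h₁ : α • R x + N (R x) = x := by simpa using DFunLike.congr_fun hR x
  have h₂ : R' (β • R x + N (R x)) = R x := by simpa using DFunLike.congr_fun hR' (R x)
  calc
    R' x - R x = R' (α • R x + N (R x)) - R' (β • R x + N (R x)) := by rw [h₁, h₂]
    _ = (α - β) • R' (R x) := by
      rw [map_add, map_add, map_smul, map_smul]
      module

/-- For a monotone operator `N`, the norm of `(α • 1 + N)⁻¹ x` is nonincreasing in `α`. -/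
lemma norm_resolvent_apply_le {H : Type*} [NormedAddCommGroup H] [InnerProductSpace ℝ H]
    {N R R' : H →L[ℝ] H} {α β : ℝ} (hβ : 0 ≤ β) (hβα : β ≤ α)
    (hN : ∀ z, 0 ≤ inner ℝ (N z) z)
    (hR : (α • (1 : H →L[ℝ] H) + N) ∘L R = 1)
    (hR' : (β • (1 : H →L[ℝ] H) + N) ∘L R' = 1 ∧ R' ∘L (β • (1 : H →L[ℝ] H) + N) = 1) (x : H) :
    ‖R x‖ ≤ ‖R' x‖ := by
  have hsub := resolvent_sub_apply hR hR'.2 x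
  set v := R x
  set z := R' v
  have hz : β • z + N z = v := by simpa using DFunLike.congr_fun hR'.1 v
  have hvz : 0 ≤ inner ℝ v z := by
    rw [← hz, inner_add_left, real_inner_smul_left]
    exact add_nonneg (mul_nonneg hβ real_inner_self_nonneg) (hN z)
  have hw : R' x = v + (α - β) • z := by rw [← hsub]; abel
  refine le_of_sq_le_sq ?_ (norm_nonneg _)
  rw [hw, norm_add_sq_real, real_inner_smul_right]
  have := mul_nonneg (sub_nonneg.2 hβα) hvz
  nlinarith [sq_nonneg ‖(α - β) • z‖]

/-- The resolvents of `A* A` and `A A*` are intertwined by `A*`. -/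
lemma adjoint_resolvent_apply {H F : Type*}
    [NormedAddCommGroup H] [InnerProductSpace ℝ H] [CompleteSpace H]
    [NormedAddCommGroup F] [InnerProductSpace ℝ F] [CompleteSpace F]
    {A : H →L[ℝ] F} {R : H →L[ℝ] H} {S : F →L[ℝ] F} {α : ℝ}
    (hR : R ∘L (α • (1 : H →L[ℝ] H) + (adjoint A) ∘L A) = 1)
    (hS : (α • (1 : F →L[ℝ] F) + A ∘L (adjoint A)) ∘L S = 1) (y : F) :
    adjoint A (S y) = R (adjoint A y) := by
  have h₁ : α • S y + A (adjoint A (S y)) = y := by simpa using DFunLike.congr_fun hS y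
  have h₂ : R (α • adjoint A (S y) + adjoint A (A (adjoint A (S y)))) = adjoint A (S y) := by
    simpa using DFunLike.congr_fun hR (adjoint A (S y))
  nth_rewrite 2 [← h₁]
  rw [map_add, map_smul, h₂]

/-- The quasi-optimality quantity at `α` equals `α ‖(αI + A*A)⁻² A* f‖`. -/
lemma quasiOptimality_eq {H F : Type*}
    [NormedAddCommGroup H] [InnerProductSpace ℝ H] [CompleteSpace H]
    [NormedAddCommGroup F] [InnerProductSpace ℝ F] [CompleteSpace F]
    {A : H →L[ℝ] F} {R : H →L[ℝ] H} {S : F →L[ℝ] F} {α : ℝ} (hα : 0 < α)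
    (hR : (α • (1 : H →L[ℝ] H) + (adjoint A) ∘L A) ∘L R = 1 ∧
      R ∘L (α • (1 : H →L[ℝ] H) + (adjoint A) ∘L A) = 1)
    (hS : (α • (1 : F →L[ℝ] F) + A ∘L (adjoint A)) ∘L S = 1) (f : F) :
    α⁻¹ * ‖adjoint A ((α • S) (A (R (adjoint A f)) - f))‖ =
      α * ‖R (R (adjoint A f))‖ := by
  have h₁ : α • R (adjoint A f) + adjoint A (A (R (adjoint A f))) = adjoint A f := by
    simpa using DFunLike.congr_fun hR.1 (adjoint A f)
  have h₂ : adjoint A (A (R (adjoint A f)) - f) = -(α • R (adjoint A f)) := by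
    rw [map_sub, sub_eq_iff_eq_add]
    nth_rewrite 3 [← h₁]
    abel
  rw [smul_apply, map_smul, adjoint_resolvent_apply hR.2 hS, h₂, map_neg, map_smul, norm_smul,
    norm_neg, norm_smul, Real.norm_of_nonneg hα.le]
  field_simp

/-- For the geometric grid α_i = α_0 q^i and indices 0 ≤ j ≤ k ≤ M:
‖u_{α_k} − u_{α_j}‖ ≤ q^{-1}(1 − q) Σ_{i=j}^{k−1} ψ_Q(α_{i+1}). -/
theorem stmt_10 {H F : Type*} [NormedAddCommGroup H] [InnerProductSpace ℝ H] [CompleteSpace H]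
    [NormedAddCommGroup F] [InnerProductSpace ℝ F] [CompleteSpace F]
    (A : H →L[ℝ] F) (f : F)
    (T : ℝ → H →L[ℝ] H)
    (hT : ∀ α : ℝ, 0 < α →
      (α • (1 : H →L[ℝ] H) + (adjoint A) ∘L A) ∘L T α = 1 ∧
      T α ∘L (α • (1 : H →L[ℝ] H) + (adjoint A) ∘L A) = 1)
    (S : ℝ → F →L[ℝ] F)
    (hS : ∀ α : ℝ, 0 < α →
      (α • (1 : F →L[ℝ] F) + A ∘L (adjoint A)) ∘L S α = 1 ∧
      S α ∘L (α • (1 : F →L[ℝ] F) + A ∘L (adjoint A)) = 1)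
    (ψQ : ℝ → ℝ)
    (hψQ : ∀ α : ℝ, ψQ α = α⁻¹ * ‖(adjoint A) ((α • S α) (A (T α ((adjoint A) f)) - f))‖)
    (q : ℝ) (hq : 0 < q) (hq1 : q < 1)
    (α0 : ℝ) (hα0 : 0 < α0) (M : ℕ)
    (j k : ℕ) (hjk : j ≤ k) (hkM : k ≤ M) :
    ‖T (α0 * q ^ k) ((adjoint A) f) - T (α0 * q ^ j) ((adjoint A) f)‖ ≤
      q⁻¹ * (1 - q) * ∑ i ∈ Finset.Ico j k, ψQ (α0 * q ^ (i + 1)) := by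
  have hN : ∀ z, 0 ≤ inner ℝ (((adjoint A) ∘L A) z) z := fun z => by
    rw [comp_apply, adjoint_inner_left]
    exact real_inner_self_nonneg
  have hstep : ∀ i, ‖T (α0 * q ^ (i + 1)) (adjoint A f) - T (α0 * q ^ i) (adjoint A f)‖ ≤
      q⁻¹ * (1 - q) * ψQ (α0 * q ^ (i + 1)) := fun i => by
    have hα : 0 < α0 * q ^ i := by positivity
    have hβ : 0 < α0 * q ^ (i + 1) := by positivity
    have hqβ : α0 * q ^ i - α0 * q ^ (i + 1) = q⁻¹ * (1 - q) * (α0 * q ^ (i + 1)) := by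
      field_simp
      ring
    have hdiff : 0 ≤ α0 * q ^ i - α0 * q ^ (i + 1) := by
      rw [hqβ]
      have := sub_pos.2 hq1
      positivity
    rw [hψQ, quasiOptimality_eq hβ (hT _ hβ) (hS _ hβ).1, ← mul_assoc, ← hqβ, norm_sub_rev,
      resolvent_sub_apply (hT _ hβ).1 (hT _ hα).2, norm_smul, norm_sub_rev,
      Real.norm_of_nonneg hdiff]
    exact mul_le_mul_of_nonneg_left
      (norm_resolvent_apply_le hβ.le (sub_nonneg.1 hdiff) hN (hT _ hα).1 (hT _ hβ) _) hdiff
  rw [← Finset.sum_Ico_sub (fun i => T (α0 * q ^ i) (adjoint A f)) hjk, Finset.mul_sum]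
  exact norm_sum_le_of_le _ fun i _ => hstep i
end
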